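/- (Lemma LEMCOD b.) Let π = σ_0 × ⋯ × σ_s be an oriented prism with Whitney form ω(π) = ω(σ_0) ∧ ⋯ ∧ ω(σ_s) (pullbacks via the projections), and let π' = σ_0 × ⋯ × σ'_i × ⋯ × σ_s be a codimension-1 face. Define ω(π';π) = ω(σ_0) ∧ ⋯ ∧ ω(σ'_i;σ_i) ∧ ⋯ ∧ ω(σ_s). Then d ω(π';π) = [π;π'] ω(π), where [π;π'] = (-1)^{|σ_0|+⋯+|σ_{i-1}|}[σ_i;σ'_i]. -/

import Mathlib

open scoped BigOperators

variable {E : Type*} [NormedAddCommGroup E] [NormedSpace ℝ E]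

/-- The Whitney form of the ordered tuple of barycentric coordinate functions
`lam 0, …, lam p` : the `p`-form
`ω = p! Σ_i (-1)^i λ_i dλ_0 ∧ ⋯ ∧ \widehat{dλ_i} ∧ ⋯ ∧ dλ_p`,
evaluated at a point `x` on the tuple of vectors `v`. -/
noncomputable def whitneyForm {p : ℕ} (lam : Fin (p + 1) → E → ℝ) (x : E)
    (v : Fin p → E) : ℝ :=
  (Nat.factorial p : ℝ) *
    ∑ i : Fin (p + 1), (-1 : ℝ) ^ (i : ℕ) * lam i x *
      Matrix.det (Matrix.of fun r c : Fin p => fderiv ℝ (lam (i.succAbove r)) x (v c))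

/-- Exterior derivative of a concrete `k`-form (a function of a point and of `k` vectors),
evaluated on constant vector fields:
`(dω)(v_0,…,v_k) = Σ_i (-1)^i ∂_{v_i} (y ↦ ω(y)(v_0,…,\widehat{v_i},…,v_k))`. -/
noncomputable def extDerivAt {k : ℕ} (ω : E → (Fin k → E) → ℝ) (x : E)
    (v : Fin (k + 1) → E) : ℝ :=
  ∑ i : Fin (k + 1), (-1 : ℝ) ^ (i : ℕ) *
    fderiv ℝ (fun y => ω y fun j => v (i.succAbove j)) x (v i)

/-- Position of the pair `(j, i)` in the concatenation of blocks of sizes `d 0, …`. -/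
def sigmaIdx {n : ℕ} (d : Fin n → ℕ) (j : Fin n) (i : Fin (d j)) : Fin (∑ k, d k) :=
  ⟨(∑ k ∈ Finset.univ.filter fun k => k < j, d k) + (i : ℕ), by
    have hj : j ∉ Finset.univ.filter fun k => k < j := by simp
    have h1 : (∑ k ∈ Finset.univ.filter fun k => k < j, d k) + d j
        = ∑ k ∈ insert j (Finset.univ.filter fun k => k < j), d k := by
      rw [Finset.sum_insert hj]; ring
    have h2 : ∑ k ∈ insert j (Finset.univ.filter fun k => k < j), d k ≤ ∑ k, d k :=
      Finset.sum_le_sum_of_subset (Finset.subset_univ _)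
    have h3 : (i : ℕ) < d j := i.isLt
    omega⟩

/-- Wedge product of a family of concrete alternating forms of degrees `d j`. -/
noncomputable def bigWedge {n : ℕ} (d : Fin n → ℕ)
    (a : (j : Fin n) → (Fin (d j) → E) → ℝ) (v : Fin (∑ k, d k) → E) : ℝ :=
  (∏ j, (Nat.factorial (d j) : ℝ))⁻¹ *
    ∑ σ : Equiv.Perm (Fin (∑ k, d k)),
      ((Equiv.Perm.sign σ : ℤ) : ℝ) * ∏ j, a j fun i => v (σ (sigmaIdx d j i))

/-- The Whitney form `ω(π) = ω(σ_0) ∧ ⋯ ∧ ω(σ_s)` of the prism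
`π = σ_0 × ⋯ × σ_s`, where the factor `σ_j` has barycentric coordinate functions
`lamF j : Fin (α j + 1) → E → ℝ`. -/
noncomputable def prismWhitney {s : ℕ} (α : Fin (s + 1) → ℕ)
    (lamF : (j : Fin (s + 1)) → Fin (α j + 1) → E → ℝ) (y : E) :
    (Fin (∑ j, α j) → E) → ℝ :=
  bigWedge α fun j => whitneyForm (lamF j) y

/-- The canonical extension `ω(π';π) = ω(σ_0) ∧ ⋯ ∧ ω(σ'_i;σ_i) ∧ ⋯ ∧ ω(σ_s)` of
the Whitney form of the codimension-1 face `π'` of the prism `π`, where the face is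
obtained by replacing the factor `σ_i` (of dimension `α i = β + 1`) by its face
`σ'_i` opposite the vertex `m`. -/
noncomputable def prismFaceExt {s : ℕ} (α : Fin (s + 1) → ℕ)
    (lamF : (j : Fin (s + 1)) → Fin (α j + 1) → E → ℝ)
    (i : Fin (s + 1)) (β : ℕ) (hβ : α i = β + 1) (m : Fin (α i + 1)) (y : E) :
    (Fin (∑ j, if j = i then β else α j) → E) → ℝ :=
  bigWedge (fun j => if j = i then β else α j)
    (fun j =>
      if h : j = i then
        fun w =>
          whitneyForm (fun k : Fin (β + 1) => lamF i (m.succAbove (Fin.cast hβ.symm k))) y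
            (fun k : Fin β => w (Fin.cast (by simp [h]) k))
      else
        fun w => whitneyForm (lamF j) y (fun k : Fin (α j) => w (Fin.cast (by simp [h]) k)))

/-! ### Combinatorial helpers -/

theorem sign_sigmaCongrRight_aux {n : ℕ} {d : Fin n → ℕ} (τ : ∀ j, Equiv.Perm (Fin (d j))) :
    Equiv.Perm.sign (Equiv.Perm.sigmaCongrRight τ) = ∏ j, Equiv.Perm.sign (τ j) := by
  let f : (∀ j, Equiv.Perm (Fin (d j))) →* ℤˣ :=
    Equiv.Perm.sign.comp (Equiv.Perm.sigmaCongrRightHom (fun j => Fin (d j)))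
  let g : (∀ j, Equiv.Perm (Fin (d j))) →* ℤˣ :=
    { toFun := fun τ => ∏ j, Equiv.Perm.sign (τ j)
      map_one' := by simp
      map_mul' := by intro a b; simp [Finset.prod_mul_distrib] }
  have hfg : f = g := by
    apply MonoidHom.pi_ext
    intro j t
    have hg : g (Pi.mulSingle j t) = Equiv.Perm.sign t := by
      show ∏ k, Equiv.Perm.sign
        ((Pi.mulSingle j t : ∀ j, Equiv.Perm (Fin (d j))) k) = _
      rw [Finset.prod_eq_single j]
      · simp
      · intro b _ hb; simp [Pi.mulSingle_eq_of_ne hb]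
      · simp
    rw [hg]
    show Equiv.Perm.sign (Equiv.Perm.sigmaCongrRight
      (Pi.mulSingle j t : ∀ j, Equiv.Perm (Fin (d j)))) = _
    symm
    refine Equiv.Perm.sign_bij (fun a _ => ⟨j, a⟩) ?_ ?_ ?_
    · intro x hx hx'
      simp
    · intro x y _ _ h
      simpa using h
    · rintro ⟨k, y⟩ hy
      by_cases hk : k = j
      · subst hk
        refine ⟨y, ?_, rfl⟩
        intro h
        apply hy
        simp [h]
      · exfalso
        apply hy
        simp [Pi.mulSingle_eq_of_ne hk]
  exact DFunLike.congr_fun hfg τ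

theorem sum_filter_lt_eq {n : ℕ} (d : Fin n → ℕ) (j : Fin n) :
    ∑ k ∈ Finset.univ.filter (fun k => k < j), d k
      = ∑ i : Fin j, d (Fin.castLE j.2.le i) := by
  symm
  refine Finset.sum_bij (fun i _ => Fin.castLE j.2.le i) ?_ ?_ ?_ ?_
  · intro a _
    rw [Finset.mem_filter]
    exact ⟨Finset.mem_univ _, a.2⟩
  · intro a _ b _ h
    exact Fin.castLE_injective _ h
  · intro b hb
    rw [Finset.mem_filter] at hb
    exact ⟨⟨b, hb.2⟩, Finset.mem_univ _, by ext; simp⟩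
  · simp

theorem sigmaIdx_eq {n : ℕ} (d : Fin n → ℕ) (j : Fin n) (i : Fin (d j)) :
    sigmaIdx d j i = finSigmaFinEquiv ⟨j, i⟩ := by
  ext
  rw [finSigmaFinEquiv_apply]
  simp only [sigmaIdx, sum_filter_lt_eq]

/-- The wedge of decomposable forms is the determinant of all the covectors. -/
theorem bigWedge_det {n : ℕ} (d : Fin n → ℕ) (c : Fin n → ℝ)
    (L : Fin (∑ k, d k) → E → ℝ) (v : Fin (∑ k, d k) → E) :
    bigWedge d (fun j w => c j * Matrix.det
      (Matrix.of fun r k : Fin (d j) => L (sigmaIdx d j r) (w k))) v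
      = (∏ j, c j) * Matrix.det (Matrix.of fun a b => L a (v b)) := by
  unfold bigWedge
  have key : ∀ σ : Equiv.Perm (Fin (∑ k, d k)),
      ((Equiv.Perm.sign σ : ℤ) : ℝ) * ∏ j, (c j * Matrix.det
        (Matrix.of fun r k : Fin (d j) => L (sigmaIdx d j r) (v (σ (sigmaIdx d j k)))))
      = (∏ j, c j) * ∑ τ : (∀ j, Equiv.Perm (Fin (d j))),
        ((Equiv.Perm.sign (σ * finSigmaFinEquiv.permCongr (Equiv.Perm.sigmaCongrRight τ)) : ℤ) : ℝ)
          * ∏ a, L a (v ((σ * finSigmaFinEquiv.permCongr (Equiv.Perm.sigmaCongrRight τ)) a)) := by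
    intro σ
    rw [Finset.prod_mul_distrib]
    simp_rw [← Matrix.det_transpose (Matrix.of fun r k => L _ _), Matrix.det_apply']
    rw [Finset.prod_univ_sum, Fintype.piFinset_univ, mul_left_comm, Finset.mul_sum]
    congr 1
    refine Finset.sum_congr rfl fun τ _ => ?_
    rw [Finset.prod_mul_distrib, Equiv.Perm.sign_mul, Equiv.Perm.sign_permCongr,
      sign_sigmaCongrRight_aux]
    rw [← Equiv.prod_comp finSigmaFinEquiv, Fintype.prod_sigma]
    push_cast
    rw [mul_assoc]
    congr 2
    refine Finset.prod_congr rfl fun j _ => Finset.prod_congr rfl fun r _ => ?_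
    simp [sigmaIdx_eq]
  rw [Finset.sum_congr rfl fun σ _ => key σ, ← Finset.mul_sum, Finset.sum_comm]
  have h2 : ∀ τ : (∀ j, Equiv.Perm (Fin (d j))),
      ∑ σ : Equiv.Perm (Fin (∑ k, d k)),
        ((Equiv.Perm.sign (σ * finSigmaFinEquiv.permCongr (Equiv.Perm.sigmaCongrRight τ)) : ℤ) : ℝ)
          * ∏ a, L a (v ((σ * finSigmaFinEquiv.permCongr (Equiv.Perm.sigmaCongrRight τ)) a))
      = Matrix.det (Matrix.of fun a b => L a (v b)) := by
    intro τ
    rw [← Matrix.det_transpose, Matrix.det_apply']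
    exact Equiv.sum_comp (Equiv.mulRight
      (finSigmaFinEquiv.permCongr (Equiv.Perm.sigmaCongrRight τ)))
      (fun σ => ((Equiv.Perm.sign σ : ℤ) : ℝ) * ∏ a, L a (v (σ a)))
  rw [Finset.sum_congr rfl fun τ _ => h2 τ, Finset.sum_const, Finset.card_univ,
    Fintype.card_pi]
  simp only [Fintype.card_perm, Fintype.card_fin, nsmul_eq_mul]
  push_cast
  have : (∏ j, (Nat.factorial (d j) : ℝ)) ≠ 0 :=
    Finset.prod_ne_zero_iff.mpr fun j _ => by positivity
  field_simp

/-! ### Calculus helpers -/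

/-- Determinant as a continuous alternating map. -/
noncomputable def detCAM (n : ℕ) : (Fin n → ℝ) [⋀^Fin n]→L[ℝ] ℝ :=
  { (Matrix.detRowAlternating : (Fin n → ℝ) [⋀^Fin n]→ₗ[ℝ] ℝ) with
    cont := by
      show Continuous fun M : Matrix (Fin n) (Fin n) ℝ => M.det
      exact Continuous.matrix_det continuous_id }

theorem detCAM_apply (n : ℕ) (w : Fin n → Fin n → ℝ) :
    detCAM n w = Matrix.det (Matrix.of w) := rfl

theorem det_eq_pullback {n : ℕ} (g : Fin n → E → ℝ) (y : E)
    (hg : ∀ r, DifferentiableAt ℝ (g r) y) (w : Fin n → E) :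
    Matrix.det (Matrix.of fun r c : Fin n => fderiv ℝ (g r) y (w c)) =
      ((detCAM n).compContinuousLinearMap (fderiv ℝ (fun z r => g r z) y)) w := by
  rw [ContinuousAlternatingMap.compContinuousLinearMap_apply, detCAM_apply,
    ← Matrix.det_transpose]
  congr 1
  ext a b
  simp [Matrix.transpose_apply, fderiv_pi hg]

theorem pullback_differentiableAt {n : ℕ} (g : Fin n → E → ℝ) (x : E)
    (hg : ∀ r, ContDiffAt ℝ 2 (g r) x) :
    DifferentiableAt ℝ (fun y => (detCAM n).compContinuousLinearMap
      (fderiv ℝ (fun z r => g r z) y)) x := by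
  have h1 : ContDiffAt ℝ 2 (fun z r => g r z) x := contDiffAt_pi.2 hg
  have h2 : DifferentiableAt ℝ (fderiv ℝ (fun z r => g r z)) x :=
    (h1.fderiv_right (m := 1) (by norm_num)).differentiableAt (by norm_num)
  exact DifferentiableAt.continuousAlternatingMapCompContinuousLinearMap
    (differentiableAt_const _) h2

theorem det_eventuallyEq {n : ℕ} (g : Fin n → E → ℝ) (x : E)
    (hg : ∀ r, ContDiffAt ℝ 2 (g r) x) (w : Fin n → E) :
    (fun y => Matrix.det (Matrix.of fun r c : Fin n => fderiv ℝ (g r) y (w c))) =ᶠ[nhds x]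
      fun y => ((detCAM n).compContinuousLinearMap (fderiv ℝ (fun z r => g r z) y)) w := by
  have : ∀ᶠ y in nhds x, ∀ r, ContDiffAt ℝ 2 (g r) y :=
    Filter.eventually_all.2 fun r => (hg r).eventually (by simp)
  filter_upwards [this] with y hy
  exact det_eq_pullback g y (fun r => (hy r).differentiableAt (by norm_num)) w

theorem det_differentiableAt {n : ℕ} (g : Fin n → E → ℝ) (x : E)
    (hg : ∀ r, ContDiffAt ℝ 2 (g r) x) (w : Fin n → E) :
    DifferentiableAt ℝ
      (fun y => Matrix.det (Matrix.of fun r c : Fin n => fderiv ℝ (g r) y (w c))) x := by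
  rw [(det_eventuallyEq g x hg w).differentiableAt_iff]
  exact (pullback_differentiableAt g x hg).continuousAlternatingMap_apply_const w

/-- `d (dg_1 ∧ ⋯ ∧ dg_n) = 0`. -/
theorem extDerivAt_det {n : ℕ} (g : Fin n → E → ℝ) (x : E)
    (hg : ∀ r, ContDiffAt ℝ 2 (g r) x) (v : Fin (n + 1) → E) :
    extDerivAt (fun y w => Matrix.det
      (Matrix.of fun r c : Fin n => fderiv ℝ (g r) y (w c))) x v = 0 := by
  have h1 : ContDiffAt ℝ 2 (fun z r => g r z) x := contDiffAt_pi.2 hg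
  have h := extDeriv_pullback (ω := fun _ => detCAM n) (f := fun z r => g r z) (x := x)
    (differentiableAt_const _) h1 (by simp)
  have h0 : extDeriv (fun _ : Fin n → ℝ => detCAM n) (fun r => g r x) = 0 := by
    rw [extDeriv, fderiv_fun_const]
    exact (ContinuousAlternatingMap.alternatizeUncurryFinCLM ℝ (Fin n → ℝ) ℝ).map_zero
  rw [h0] at h
  have h' := congrArg (fun T => T v) h
  rw [extDeriv_apply (pullback_differentiableAt g x hg)] at h'
  unfold extDerivAt
  refine Eq.trans (Finset.sum_congr rfl fun i _ => ?_) (h'.trans (by simp))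
  rw [(det_eventuallyEq g x hg _).fderiv_eq, zsmul_eq_mul]
  push_cast
  rfl

/-- `d (h_p dh_0 ∧ ⋯ \widehat{dh_p} ⋯ ∧ dh_n) = (-1)^p dh_0 ∧ ⋯ ∧ dh_n`. -/
theorem extDerivAt_mul_det {n : ℕ} (H : Fin (n + 1) → E → ℝ) (x : E)
    (hH : ∀ r, ContDiffAt ℝ 2 (H r) x) (p : Fin (n + 1)) (v : Fin (n + 1) → E) :
    extDerivAt (fun y w => H p y * Matrix.det
      (Matrix.of fun r c : Fin n => fderiv ℝ (H (p.succAbove r)) y (w c))) x v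
      = (-1 : ℝ) ^ (p : ℕ) * Matrix.det (Matrix.of fun r c => fderiv ℝ (H r) x (v c)) := by
  have h0 := extDerivAt_det (fun r => H (p.succAbove r)) x (fun r => hH _) v
  rw [Matrix.det_succ_row _ p]
  unfold extDerivAt at h0 ⊢
  have : ∀ i : Fin (n + 1), (-1 : ℝ) ^ (i : ℕ) *
      fderiv ℝ (fun y => H p y * Matrix.det (Matrix.of fun r c : Fin n =>
        fderiv ℝ (H (p.succAbove r)) y (v (i.succAbove c)))) x (v i)
      = H p x * ((-1 : ℝ) ^ (i : ℕ) * fderiv ℝ (fun y => Matrix.det (Matrix.of fun r c : Fin n =>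
        fderiv ℝ (H (p.succAbove r)) y (v (i.succAbove c)))) x (v i)) +
        (-1 : ℝ) ^ (p : ℕ) * ((-1) ^ (p + i : ℕ) * fderiv ℝ (H p) x (v i) *
        Matrix.det (Matrix.of fun r c : Fin n =>
        fderiv ℝ (H (p.succAbove r)) x (v (i.succAbove c)))) := by
    intro i
    rw [fderiv_fun_mul ((hH p).differentiableAt (by norm_num))
      (det_differentiableAt _ x (fun r => hH _) _)]
    simp only [add_apply, smul_apply, smul_eq_mul]
    have e : (-1 : ℝ) ^ (p : ℕ) * (-1) ^ (p : ℕ) = 1 := by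
      rw [← mul_pow]; simp
    rw [pow_add]
    linear_combination (-((-1 : ℝ) ^ (i : ℕ) * fderiv ℝ (H p) x (v i) *
        Matrix.det (Matrix.of fun r c : Fin n =>
        fderiv ℝ (H (p.succAbove r)) x (v (i.succAbove c))))) * e
  rw [Finset.sum_congr rfl fun i _ => this i, Finset.sum_add_distrib, ← Finset.mul_sum, h0,
    ← Finset.mul_sum, mul_zero, zero_add]
  rfl

/-- When the functions add up to one, the Whitney form is decomposable. -/
theorem whitneyForm_eq {p : ℕ} (lam : Fin (p + 1) → E → ℝ) (U : Set E) (hU : IsOpen U)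
    (hd : ∀ i, DifferentiableOn ℝ (lam i) U) (hs : ∀ y ∈ U, ∑ i, lam i y = 1)
    (m : Fin (p + 1)) (y : E) (hy : y ∈ U) (w : Fin p → E) :
    whitneyForm lam y w = ((Nat.factorial p : ℝ) * (-1) ^ (m : ℕ)) *
      Matrix.det (Matrix.of fun r c : Fin p => fderiv ℝ (lam (m.succAbove r)) y (w c)) := by
  have hz : ∑ i, fderiv ℝ (lam i) y = 0 := by
    rw [← fderiv_fun_sum fun i _ => (hd i).differentiableAt (hU.mem_nhds hy)]
    have : (fun z => ∑ i, lam i z) =ᶠ[nhds y] fun _ => (1 : ℝ) := by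
      filter_upwards [hU.mem_nhds hy] with z hz using hs z hz
    rw [this.fderiv_eq]; simp
  let M : Matrix (Fin (p + 1)) (Fin p) ℝ := Matrix.of fun r c => fderiv ℝ (lam r) y (w c)
  have hM : ∑ j, M j = 0 := by
    ext c
    have := congrArg (fun T => T (w c)) hz
    refine (Finset.sum_apply c _ (fun j => (fun c => M j c))).trans ?_
    simpa [M] using this
  have hk : ∀ i : Fin (p + 1), (-1 : ℝ) ^ (i : ℕ) *
      Matrix.det (Matrix.of fun r c : Fin p => fderiv ℝ (lam (i.succAbove r)) y (w c)) =
      (-1 : ℝ) ^ (m : ℕ) *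
      Matrix.det (Matrix.of fun r c : Fin p => fderiv ℝ (lam (m.succAbove r)) y (w c)) := by
    intro i
    have h := Matrix.submatrix_succAbove_det_eq_negOnePow_submatrix_succAbove_det M hM i m
    have e1 : (M.submatrix (Fin.succAbove i) id) =
      Matrix.of fun r c : Fin p => fderiv ℝ (lam (i.succAbove r)) y (w c) := rfl
    have e2 : (M.submatrix (Fin.succAbove m) id) =
      Matrix.of fun r c : Fin p => fderiv ℝ (lam (m.succAbove r)) y (w c) := rfl
    rw [e1, e2] at h
    rw [h, Int.negOnePow_sub, Int.negOnePow_def, Int.negOnePow_def]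
    simp only [zpow_natCast, Units.smul_def, zsmul_eq_mul]
    push_cast
    have e : (-1 : ℝ) ^ (i : ℕ) * (-1) ^ (i : ℕ) = 1 := by
      rw [← mul_pow]; simp
    linear_combination ((-1 : ℝ) ^ (m : ℕ) *
      Matrix.det (Matrix.of fun r c : Fin p => fderiv ℝ (lam (m.succAbove r)) y (w c))) * e
  unfold whitneyForm
  have : ∀ i : Fin (p + 1), (-1 : ℝ) ^ (i : ℕ) * lam i y *
      Matrix.det (Matrix.of fun r c : Fin p => fderiv ℝ (lam (i.succAbove r)) y (w c)) =
      lam i y * ((-1 : ℝ) ^ (m : ℕ) *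
      Matrix.det (Matrix.of fun r c : Fin p => fderiv ℝ (lam (m.succAbove r)) y (w c))) := by
    intro i; rw [← hk i]; ring
  rw [Finset.sum_congr rfl fun i _ => this i, ← Finset.sum_mul, hs y hy]
  ring

/-! ### Assembly -/

theorem bigWedge_linear {n : ℕ} (d : Fin n → ℕ) {K : Type*} [Fintype K]
    (a : (j : Fin n) → (Fin (d j) → E) → ℝ) (e : K → ℝ)
    (b : K → (j : Fin n) → (Fin (d j) → E) → ℝ) (i : Fin n)
    (hi : ∀ w, a i w = ∑ k, e k * b k i w) (hne : ∀ k, ∀ j, j ≠ i → ∀ w, a j w = b k j w)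
    (v : Fin (∑ k, d k) → E) :
    bigWedge d a v = ∑ k, e k * bigWedge d (b k) v := by
  unfold bigWedge
  have h : ∀ w : (j : Fin n) → (Fin (d j) → E),
      ∏ j, a j (w j) = ∑ k, e k * ∏ j, b k j (w j) := by
    intro w
    rw [← Finset.mul_prod_erase _ _ (Finset.mem_univ i), hi, Finset.sum_mul]
    refine Finset.sum_congr rfl fun k _ => ?_
    rw [← Finset.mul_prod_erase _ (fun j => b k j (w j)) (Finset.mem_univ i), mul_assoc]
    congr 2
    exact Finset.prod_congr rfl fun j hj => hne k j (Finset.ne_of_mem_erase hj) _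
  have h' : ∀ σ : Equiv.Perm (Fin (∑ k, d k)),
      ((Equiv.Perm.sign σ : ℤ) : ℝ) * ∏ j, a j (fun i => v (σ (sigmaIdx d j i)))
      = ∑ k, e k * (((Equiv.Perm.sign σ : ℤ) : ℝ) *
        ∏ j, b k j (fun i => v (σ (sigmaIdx d j i)))) := by
    intro σ
    rw [h fun j i => v (σ (sigmaIdx d j i)), Finset.mul_sum]
    exact Finset.sum_congr rfl fun k _ => by ring
  rw [Finset.sum_congr rfl fun σ _ => h' σ, Finset.sum_comm, Finset.mul_sum]
  refine Finset.sum_congr rfl fun k _ => ?_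
  rw [← Finset.mul_sum]
  ring

theorem det_cast_aux {p q : ℕ} (h : p = q) (A : Fin q → Fin q → ℝ) :
    Matrix.det (Matrix.of fun r c : Fin p => A (Fin.cast h r) (Fin.cast h c))
      = Matrix.det (Matrix.of A) := by
  subst h; rfl

theorem blockStart_mono {n : ℕ} (d : Fin n → ℕ) {j l : Fin n} (h : j < l) :
    ∑ k ∈ Finset.univ.filter (fun k => k < j), d k + d j
      ≤ ∑ k ∈ Finset.univ.filter (fun k => k < l), d k := by
  have hj : j ∉ Finset.univ.filter fun k => k < j := by simp
  rw [add_comm, ← Finset.sum_insert hj]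
  refine Finset.sum_le_sum_of_subset fun k hk => ?_
  rw [Finset.mem_insert, Finset.mem_filter] at hk
  rw [Finset.mem_filter]
  refine ⟨Finset.mem_univ _, ?_⟩
  rcases hk with rfl | hk
  · exact h
  · exact hk.2.trans h

theorem blockStart_le {n : ℕ} (α : Fin n → ℕ) (i : Fin n) (β : ℕ) {j : Fin n} (h : j ≤ i) :
    ∑ k ∈ Finset.univ.filter (fun k => k < j), (if k = i then β else α k)
      = ∑ k ∈ Finset.univ.filter (fun k => k < j), α k := by
  refine Finset.sum_congr rfl fun k hk => ?_
  rw [Finset.mem_filter] at hk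
  rw [if_neg (hk.2.trans_le h).ne]

theorem blockStart_gt {n : ℕ} (α : Fin n → ℕ) (i : Fin n) (β : ℕ) (hβ : α i = β + 1)
    {j : Fin n} (h : i < j) :
    ∑ k ∈ Finset.univ.filter (fun k => k < j), (if k = i then β else α k) + 1
      = ∑ k ∈ Finset.univ.filter (fun k => k < j), α k := by
  have hm : i ∈ Finset.univ.filter (fun k => k < j) := by simp [h]
  rw [← Finset.add_sum_erase _ _ hm, ← Finset.add_sum_erase _ α hm, if_pos rfl, hβ]
  have : ∑ k ∈ (Finset.univ.filter (fun k => k < j)).erase i, (if k = i then β else α k)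
      = ∑ k ∈ (Finset.univ.filter (fun k => k < j)).erase i, α k :=
    Finset.sum_congr rfl fun k hk => by rw [if_neg (Finset.ne_of_mem_erase hk)]
  omega

section idx

variable {n : ℕ} (α : Fin n → ℕ) (i : Fin n) (β : ℕ) (hβ : α i = β + 1)
  (hsum' : (∑ j, if j = i then β else α j) + 1 = ∑ j, α j)

/-- Position of the omitted covector. -/
def posIdx (k : Fin (β + 1)) : Fin ((∑ j, if j = i then β else α j) + 1) :=
  Fin.cast hsum'.symm (sigmaIdx α i (Fin.cast hβ.symm k))

theorem idx_ne (k : Fin (β + 1)) (j : Fin n) (hj : j ≠ i)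
    (r : Fin (if j = i then β else α j)) (r' : Fin (α j)) (hr : (r : ℕ) = r') :
    Fin.cast hsum' ((posIdx α i β hβ hsum' k).succAbove
      (sigmaIdx (fun j => if j = i then β else α j) j r)) = sigmaIdx α j r' := by
  have hk := k.2
  have hr' := r'.2
  ext
  rcases lt_or_gt_of_ne hj with h | h
  · have h1 := blockStart_mono α h
    have h2 := blockStart_le α i β h.le
    rw [Fin.succAbove_of_castSucc_lt]
    · simp only [sigmaIdx, Fin.val_cast, Fin.val_castSucc]
      omega
    · rw [Fin.lt_def]
      simp only [sigmaIdx, posIdx, Fin.val_cast, Fin.val_castSucc]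
      omega
  · have h1 := blockStart_mono α h
    have h2 := blockStart_gt α i β hβ h
    rw [Fin.succAbove_of_le_castSucc]
    · simp only [sigmaIdx, Fin.val_cast, Fin.val_succ]
      omega
    · rw [Fin.le_def]
      simp only [sigmaIdx, posIdx, Fin.val_cast, Fin.val_castSucc]
      omega

theorem idx_eq (k : Fin (β + 1))
    (r : Fin (if i = i then β else α i)) (r' : Fin β) (hr : (r : ℕ) = r') :
    Fin.cast hsum' ((posIdx α i β hβ hsum' k).succAbove
      (sigmaIdx (fun j => if j = i then β else α j) i r)) =
      sigmaIdx α i (Fin.cast hβ.symm (k.succAbove r')) := by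
  have hk := k.2
  have h2 := blockStart_le α i β (le_refl i)
  ext
  by_cases h : (r' : ℕ) < k
  · rw [Fin.succAbove_of_castSucc_lt, Fin.succAbove_of_castSucc_lt]
    · simp only [sigmaIdx, Fin.val_cast, Fin.val_castSucc]
      omega
    · simpa only [Fin.lt_def, Fin.val_castSucc] using h
    · rw [Fin.lt_def]
      simp only [sigmaIdx, posIdx, Fin.val_cast, Fin.val_castSucc]
      omega
  · rw [Fin.succAbove_of_le_castSucc, Fin.succAbove_of_le_castSucc]
    · simp only [sigmaIdx, Fin.val_cast, Fin.val_succ]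
      omega
    · simpa only [Fin.le_def, Fin.val_castSucc, not_lt] using h
    · rw [Fin.le_def]
      simp only [sigmaIdx, posIdx, Fin.val_cast, Fin.val_castSucc]
      omega

end idx

theorem extDerivAt_sum {n : ℕ} {K : Type*} [Fintype K] (t : K → ℝ)
    (ω : E → (Fin n → E) → ℝ) (F : K → E → (Fin n → E) → ℝ) (x : E)
    (heq : ∀ᶠ y in nhds x, ∀ w, ω y w = ∑ k, t k * F k y w)
    (hF : ∀ k w, DifferentiableAt ℝ (fun y => F k y w) x) (v : Fin (n + 1) → E) :
    extDerivAt ω x v = ∑ k, t k * extDerivAt (F k) x v := by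
  unfold extDerivAt
  have : ∀ j : Fin (n + 1), (-1 : ℝ) ^ (j : ℕ) *
      fderiv ℝ (fun y => ω y fun l => v (j.succAbove l)) x (v j) =
      ∑ k, t k * ((-1 : ℝ) ^ (j : ℕ) *
        fderiv ℝ (fun y => F k y fun l => v (j.succAbove l)) x (v j)) := by
    intro j
    have e : (fun y => ω y fun l => v (j.succAbove l)) =ᶠ[nhds x]
        fun y => ∑ k, t k * F k y fun l => v (j.succAbove l) := by
      filter_upwards [heq] with y hy using hy _
    rw [e.fderiv_eq, fderiv_fun_sum fun k _ => (hF k _).const_mul (t k)]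
    rw [sum_apply, Finset.mul_sum]
    refine Finset.sum_congr rfl fun k _ => ?_
    rw [fderiv_const_mul (hF k _), smul_apply, smul_eq_mul]
    ring
  rw [Finset.sum_congr rfl fun j _ => this j, Finset.sum_comm]
  exact Finset.sum_congr rfl fun k _ => by rw [Finset.mul_sum]

/-- Lemma `LEMCOD` b: for a codimension-1 face `π'` of the oriented
prism `π = σ_0 × ⋯ × σ_s` (face at factor `i`, opposite vertex `m`),
`d ω(π';π) = [π;π'] ω(π)` with `[π;π'] = (-1)^{|σ_0|+⋯+|σ_{i-1}|} [σ_i;σ'_i]`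
and `[σ_i;σ'_i] = (-1)^m`. -/
theorem extDeriv_prismFaceExt {s : ℕ} (α : Fin (s + 1) → ℕ)
    (lamF : (j : Fin (s + 1)) → Fin (α j + 1) → E → ℝ)
    (sset : Set E) (hso : IsOpen sset)
    (hsm : ∀ j i, ContDiffOn ℝ (⊤ : ℕ∞) (lamF j i) sset)
    (hsum : ∀ j, ∀ y ∈ sset, ∑ i, lamF j i y = 1)
    (i : Fin (s + 1)) (β : ℕ) (hβ : α i = β + 1) (m : Fin (α i + 1))
    (hsum' : (∑ j, if j = i then β else α j) + 1 = ∑ j, α j)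
    (x : E) (hx : x ∈ sset) (v : Fin (∑ j, α j) → E) :
    extDerivAt (fun y => prismFaceExt α lamF i β hβ m y) x
        (fun k => v (Fin.cast hsum' k)) =
      (-1 : ℝ) ^ (∑ k ∈ Finset.univ.filter fun k => k < i, α k) * (-1 : ℝ) ^ (m : ℕ) *
        prismWhitney α lamF x v := by
  classical
  let mm : ∀ j, Fin (α j + 1) := Function.update (fun _ => 0) i m
  have hmm : mm i = m := Function.update_self ..
  let H0 : Fin (∑ j, α j) → E → ℝ := fun a =>
    lamF (finSigmaFinEquiv.symm a).1
      ((mm (finSigmaFinEquiv.symm a).1).succAbove (finSigmaFinEquiv.symm a).2)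
  have hH0 : ∀ j r, H0 (sigmaIdx α j r) = lamF j ((mm j).succAbove r) := by
    intro j r
    simp only [H0, sigmaIdx_eq]
    rw [Equiv.symm_apply_apply]
  let H : Fin ((∑ j, if j = i then β else α j) + 1) → E → ℝ := fun a => H0 (Fin.cast hsum' a)
  have hH : ∀ r, ContDiffAt ℝ 2 (H r) x := fun r =>
    ((hsm _ _).contDiffAt (hso.mem_nhds hx)).of_le (WithTop.coe_le_coe.2 (le_top : (2 : ℕ∞) ≤ ⊤))
  have hdiff : ∀ j k, DifferentiableOn ℝ (lamF j k) sset := fun j k =>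
    (hsm j k).differentiableOn (by simp)
  let c : Fin (s + 1) → ℝ := fun j => (Nat.factorial (α j) : ℝ) * (-1) ^ (mm j : ℕ)
  let c' : Fin (s + 1) → ℝ := Function.update c i (Nat.factorial β : ℝ)
  let pos := posIdx α i β hβ hsum'
  have hpos : ∀ k, H (pos k) = lamF i (m.succAbove (Fin.cast hβ.symm k)) := by
    intro k
    have : H (pos k) = H0 (sigmaIdx α i (Fin.cast hβ.symm k)) := rfl
    rw [this, hH0, hmm]
  -- the right-hand side
  have hR : prismWhitney α lamF x v =
      (∏ j, c j) * Matrix.det (Matrix.of fun a b => fderiv ℝ (H0 a) x (v b)) := by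
    rw [← bigWedge_det α c (fun a => fderiv ℝ (H0 a) x) v]
    unfold prismWhitney
    congr 1
    funext j w
    rw [whitneyForm_eq (lamF j) sset hso (hdiff j) (hsum j) (mm j) x hx w]
    simp only [hH0, c]
  -- the left-hand side
  have hL : ∀ y ∈ sset, ∀ w, prismFaceExt α lamF i β hβ m y w =
      ∑ k : Fin (β + 1), ((-1 : ℝ) ^ (k : ℕ) * ∏ j, c' j) * (H (pos k) y * Matrix.det
        (Matrix.of fun r b => fderiv ℝ (H ((pos k).succAbove r)) y (w b))) := by
    intro y hy w
    unfold prismFaceExt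
    rw [bigWedge_linear (K := Fin (β + 1)) _ _ (fun k => (-1 : ℝ) ^ (k : ℕ) * H (pos k) y)
      (fun k j w => c' j * Matrix.det (Matrix.of fun r b =>
        fderiv ℝ (H ((pos k).succAbove
          (sigmaIdx (fun j => if j = i then β else α j) j r))) y (w b))) i]
    · refine Finset.sum_congr rfl fun k _ => ?_
      rw [bigWedge_det _ c' (fun a => fderiv ℝ (H ((pos k).succAbove a)) y) w]
      ring
    · intro u
      rw [dif_pos rfl]
      unfold whitneyForm
      rw [Finset.mul_sum]
      refine Finset.sum_congr rfl fun k _ => ?_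
      have hc' : c' i = (Nat.factorial β : ℝ) := Function.update_self ..
      have hdet := det_cast_aux (show β = (if i = i then β else α i) by simp)
        (fun r b => fderiv ℝ (H ((pos k).succAbove
          (sigmaIdx (fun j => if j = i then β else α j) i r))) y (u b))
      rw [hc', ← hdet, hpos]
      have hrow : ∀ r : Fin β, H ((pos k).succAbove
          (sigmaIdx (fun j => if j = i then β else α j) i
            (Fin.cast (show β = (if i = i then β else α i) by simp) r)))
          = lamF i (m.succAbove (Fin.cast hβ.symm (k.succAbove r))) := by
        intro r
        show H0 (Fin.cast hsum' ((posIdx α i β hβ hsum' k).succAbove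
          (sigmaIdx (fun j => if j = i then β else α j) i _))) = _
        rw [idx_eq α i β hβ hsum' k _ r rfl, hH0, hmm]
      simp only [hrow]
      ring
    · intro k j hj u
      rw [dif_neg hj]
      rw [whitneyForm_eq (lamF j) sset hso (hdiff j) (hsum j) (mm j) y hy]
      have hc' : c' j = c j := Function.update_of_ne hj ..
      have hdet := det_cast_aux (show α j = (if j = i then β else α j) by simp [hj])
        (fun r b => fderiv ℝ (H ((pos k).succAbove
          (sigmaIdx (fun j => if j = i then β else α j) j r))) y (u b))
      rw [hc', ← hdet]
      have hrow : ∀ r : Fin (α j), H ((pos k).succAbove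
          (sigmaIdx (fun j => if j = i then β else α j) j
            (Fin.cast (show α j = (if j = i then β else α j) by simp [hj]) r)))
          = lamF j ((mm j).succAbove r) := by
        intro r
        show H0 (Fin.cast hsum' ((posIdx α i β hβ hsum' k).succAbove
          (sigmaIdx (fun j => if j = i then β else α j) j _))) = _
        rw [idx_ne α i β hβ hsum' k j hj _ r rfl, hH0]
      simp only [hrow, c]
  rw [extDerivAt_sum (K := Fin (β + 1)) (fun k => (-1 : ℝ) ^ (k : ℕ) * ∏ j, c' j) _
    (fun k y w => H (pos k) y * Matrix.det
        (Matrix.of fun r b => fderiv ℝ (H ((pos k).succAbove r)) y (w b))) x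
    (by filter_upwards [hso.mem_nhds hx] with y hy using hL y hy)
    (fun k w => ((hH _).differentiableAt (by norm_num)).mul
      (det_differentiableAt _ x (fun r => hH _) w))]
  have hdet := det_cast_aux hsum' (fun a b => fderiv ℝ (H0 a) x (v b))
  have hterm : ∀ k : Fin (β + 1), ((-1 : ℝ) ^ (k : ℕ) * ∏ j, c' j) *
      extDerivAt (fun y w => H (pos k) y * Matrix.det
        (Matrix.of fun r b => fderiv ℝ (H ((pos k).succAbove r)) y (w b))) x
        (fun k => v (Fin.cast hsum' k)) =
      (-1 : ℝ) ^ (∑ k ∈ Finset.univ.filter fun k => k < i, α k) * (∏ j, c' j) *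
        Matrix.det (Matrix.of fun a b => fderiv ℝ (H0 a) x (v b)) := by
    intro k
    rw [extDerivAt_mul_det H x hH (pos k), ← hdet]
    have hv : ((pos k : Fin _) : ℕ)
        = (∑ k ∈ Finset.univ.filter fun k => k < i, α k) + (k : ℕ) := rfl
    rw [hv, pow_add]
    have e : (-1 : ℝ) ^ (k : ℕ) * (-1) ^ (k : ℕ) = 1 := by
      rw [← mul_pow]; simp
    linear_combination ((-1 : ℝ) ^ (∑ k ∈ Finset.univ.filter fun k => k < i, α k) *
      (∏ j, c' j) * Matrix.det (Matrix.of fun r b : Fin _ =>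
        fderiv ℝ (H0 (Fin.cast hsum' r)) x (v (Fin.cast hsum' b)))) * e
  rw [Finset.sum_congr rfl fun k _ => hterm k, Finset.sum_const, Finset.card_univ,
    Fintype.card_fin, nsmul_eq_mul, hR]
  have hc1 : ∏ j, c' j = (Nat.factorial β : ℝ) * ∏ j ∈ Finset.univ.erase i, c j := by
    rw [← Finset.mul_prod_erase _ _ (Finset.mem_univ i)]
    congr 1
    · exact Function.update_self ..
    · exact Finset.prod_congr rfl fun j hj => Function.update_of_ne (Finset.ne_of_mem_erase hj) ..
  have hc2 : ∏ j, c j = ((Nat.factorial (α i) : ℝ) * (-1) ^ (m : ℕ)) *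
      ∏ j ∈ Finset.univ.erase i, c j := by
    rw [← Finset.mul_prod_erase _ _ (Finset.mem_univ i)]
    simp only [c, hmm]
  have hfac : (Nat.factorial (α i) : ℝ) = ((β + 1 : ℕ) : ℝ) * Nat.factorial β := by
    rw [hβ, Nat.factorial_succ]; push_cast; ring
  rw [hc1, hc2, hfac]
  have e : (-1 : ℝ) ^ (m : ℕ) * (-1) ^ (m : ℕ) = 1 := by
    rw [← mul_pow]; simp
  linear_combination (-((-1 : ℝ) ^ (∑ k ∈ Finset.univ.filter fun k => k < i, α k) *
    ((β + 1 : ℕ) : ℝ) * Nat.factorial β * (∏ j ∈ Finset.univ.erase i, c j) *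
    Matrix.det (Matrix.of fun a b => fderiv ℝ (H0 a) x (v b)))) * e
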